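/- Let N be a v×v 0-1 matrix with N·Nᵀ = Nᵀ·N = k·I + λ₁·(K − I) + λ₂·(J − K), where v = m·n and K = I_m ⊗ J_n (N is the incidence matrix of a symmetric divisible design with parameters (v, k, λ₁, λ₂, m, n)). Suppose k = c·m for a natural number c and K·N = N·K = c·J (every block contains exactly k/m points from each point class, and dually). If 2·(m − 1)·c = λ₂ + (m − 2)·n, then the 2v×2v matrix A* = [[J − K, N],[Nᵀ, J − K]] satisfies A*² = (k + (m−1)n)·I + (λ₁ + (m−1)n)·(K* − I) + (λ₂ + (m−2)n)·(J* − K*), where K* = I_{2m} ⊗ J_n is the block-diagonal matrix with diagonal blocks K, K and J* is the all-ones 2v×2v matrix; that is, A* is the adjacency matrix of a divisible design graph with parameters (2v, k + (m−1)n, λ₁ + (m−1)n, λ₂ + (m−2)n, 2m, n). -/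

import Mathlib

open Matrix Kronecker

/-- The all-ones matrix. -/
def allOnes (ι : Type*) : Matrix ι ι ℝ := Matrix.of fun _ _ => 1

/-- The block-diagonal matrix `K = I_m ⊗ J_n` with `m` diagonal blocks `J_n`. -/
def Kmat (m n : ℕ) : Matrix (Fin m × Fin n) (Fin m × Fin n) ℝ :=
  (1 : Matrix (Fin m) (Fin m) ℝ) ⊗ₖ allOnes (Fin n)

/-- `A` is the adjacency matrix of a divisible design graph whose canonical
partition has classes indexed by `cl` and class members indexed by `pt`. -/
def IsDDGAdj {cl pt : Type*} [Fintype cl] [DecidableEq cl] [Fintype pt] [DecidableEq pt]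
    (k l1 l2 : ℝ) (A : Matrix (cl × pt) (cl × pt) ℝ) : Prop :=
  A.IsSymm ∧ (∀ x y, A x y = 0 ∨ A x y = 1) ∧ (∀ x, A x x = 0) ∧
  A * A = k • (1 : Matrix (cl × pt) (cl × pt) ℝ)
      + l1 • ((1 : Matrix cl cl ℝ) ⊗ₖ allOnes pt - 1)
      + l2 • (allOnes (cl × pt) - (1 : Matrix cl cl ℝ) ⊗ₖ allOnes pt)

/-- The `2v × 2v` matrix `A* = [[J − K, N], [Nᵀ, J − K]]`: points are the first `v`
vertices and blocks are the last `v` vertices; a point and a block are adjacent iff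
incident, and two points (blocks) are adjacent iff they lie in different classes. -/
def sddGraph (m n : ℕ) (N : Matrix (Fin m × Fin n) (Fin m × Fin n) ℝ) :
    Matrix ((Fin 2 × Fin m) × Fin n) ((Fin 2 × Fin m) × Fin n) ℝ :=
  Matrix.of fun x y =>
    if x.1.1 = y.1.1 then (allOnes (Fin m × Fin n) - Kmat m n) (x.1.2, x.2) (y.1.2, y.2)
    else if x.1.1 = 0 then N (x.1.2, x.2) (y.1.2, y.2)
    else N (y.1.2, y.2) (x.1.2, x.2)

theorem allOnes_mul_allOnes (ι : Type*) [Fintype ι] :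
    allOnes ι * allOnes ι = (Fintype.card ι : ℝ) • allOnes ι := by
  ext x y
  simp [allOnes, Matrix.mul_apply]

theorem transpose_allOnes (ι : Type*) : (allOnes ι)ᵀ = allOnes ι := rfl

theorem allOnes_prod (ι κ : Type*) : allOnes (ι × κ) = allOnes ι ⊗ₖ allOnes κ := by
  ext x y
  simp [allOnes]

theorem Kmat_apply (m n : ℕ) (x y : Fin m × Fin n) :
    Kmat m n x y = if x.1 = y.1 then 1 else 0 := by
  simp [Kmat, allOnes, Matrix.one_apply]

theorem transpose_Kmat (m n : ℕ) : (Kmat m n)ᵀ = Kmat m n := by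
  ext x y
  simp [Kmat_apply, eq_comm]

theorem Kmat_mul_Kmat (m n : ℕ) : Kmat m n * Kmat m n = (n : ℝ) • Kmat m n := by
  rw [Kmat, ← Matrix.mul_kronecker_mul, allOnes_mul_allOnes, Matrix.kronecker_smul]
  simp

theorem Kmat_mul_allOnes (m n : ℕ) :
    Kmat m n * allOnes (Fin m × Fin n) = (n : ℝ) • allOnes (Fin m × Fin n) := by
  rw [Kmat, allOnes_prod, ← Matrix.mul_kronecker_mul, allOnes_mul_allOnes,
    Matrix.kronecker_smul]
  simp

theorem allOnes_mul_Kmat (m n : ℕ) :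
    allOnes (Fin m × Fin n) * Kmat m n = (n : ℝ) • allOnes (Fin m × Fin n) := by
  rw [Kmat, allOnes_prod, ← Matrix.mul_kronecker_mul, allOnes_mul_allOnes,
    Matrix.kronecker_smul]
  simp

/-- The adjacency matrix `J - K` of the complete multipartite graph squares to
`(m - 2) n J + n K`. -/
theorem allOnes_sub_Kmat_mul_self (m n : ℕ) :
    (allOnes (Fin m × Fin n) - Kmat m n) * (allOnes (Fin m × Fin n) - Kmat m n) =
      (((m : ℝ) - 2) * n) • allOnes (Fin m × Fin n) + (n : ℝ) • Kmat m n := by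
  rw [sub_mul, mul_sub, mul_sub, allOnes_mul_allOnes, allOnes_mul_Kmat, Kmat_mul_allOnes,
    Kmat_mul_Kmat, Fintype.card_prod, Fintype.card_fin, Fintype.card_fin, Nat.cast_mul]
  module

theorem allOnes_mul_of_Kmat_mul {m n : ℕ} (hn : n ≠ 0) {c : ℝ}
    {N : Matrix (Fin m × Fin n) (Fin m × Fin n) ℝ}
    (hKN : Kmat m n * N = c • allOnes (Fin m × Fin n)) :
    allOnes (Fin m × Fin n) * N = (m * c) • allOnes (Fin m × Fin n) := by
  have hn' : (n : ℝ) ≠ 0 := Nat.cast_ne_zero.mpr hn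
  apply smul_right_injective _ hn'
  simp only
  rw [← Matrix.smul_mul, ← allOnes_mul_Kmat, Matrix.mul_assoc, hKN, Matrix.mul_smul,
    allOnes_mul_allOnes, Fintype.card_prod, Fintype.card_fin, Fintype.card_fin, Nat.cast_mul]
  module

theorem mul_allOnes_of_mul_Kmat {m n : ℕ} (hn : n ≠ 0) {c : ℝ}
    {N : Matrix (Fin m × Fin n) (Fin m × Fin n) ℝ}
    (hNK : N * Kmat m n = c • allOnes (Fin m × Fin n)) :
    N * allOnes (Fin m × Fin n) = (m * c) • allOnes (Fin m × Fin n) := by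
  have h : Kmat m n * Nᵀ = c • allOnes (Fin m × Fin n) := by
    simpa [transpose_Kmat, transpose_allOnes] using congrArg Matrix.transpose hNK
  simpa [transpose_allOnes] using congrArg Matrix.transpose (allOnes_mul_of_Kmat_mul hn h)

/-- `(J - K) N + N (J - K) = 2 (m - 1) c J` when `K N = N K = c J`. -/
theorem allOnes_sub_Kmat_mul_add_mul {m n : ℕ} (hn : n ≠ 0) {c : ℝ}
    {N : Matrix (Fin m × Fin n) (Fin m × Fin n) ℝ}
    (hKN : Kmat m n * N = c • allOnes (Fin m × Fin n))
    (hNK : N * Kmat m n = c • allOnes (Fin m × Fin n)) :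
    (allOnes (Fin m × Fin n) - Kmat m n) * N + N * (allOnes (Fin m × Fin n) - Kmat m n) =
      (2 * ((m : ℝ) - 1) * c) • allOnes (Fin m × Fin n) := by
  rw [sub_mul, mul_sub, allOnes_mul_of_Kmat_mul hn hKN, mul_allOnes_of_mul_Kmat hn hNK, hKN, hNK]
  module

/-- The square of `sddGraph`, computed blockwise. -/
theorem sddGraph_mul_self_apply (m n : ℕ) (N : Matrix (Fin m × Fin n) (Fin m × Fin n) ℝ)
    (i j : Fin 2) (a b : Fin m) (p q : Fin n) :
    (sddGraph m n N * sddGraph m n N) ((i, a), p) ((j, b), q) =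
      (let M := allOnes (Fin m × Fin n) - Kmat m n
      if i = j then (if i = 0 then M * M + N * Nᵀ else M * M + Nᵀ * N) (a, p) (b, q)
      else if i = 0 then (M * N + N * M) (a, p) (b, q)
      else (M * N + N * M) (b, q) (a, p)) := by
  have hM : ∀ x y, (allOnes (Fin m × Fin n) - Kmat m n) x y =
      (allOnes (Fin m × Fin n) - Kmat m n) y x := fun x y => by
    simp [allOnes, Kmat_apply, eq_comm]
  simp only [Matrix.sub_apply] at hM
  simp only [Matrix.mul_apply, Matrix.add_apply, Fintype.sum_prod_type, Fin.sum_univ_two]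
  fin_cases i <;> fin_cases j <;>
    simp [sddGraph, Matrix.mul_apply, Matrix.add_apply, Fintype.sum_prod_type,
      -Finset.sum_sub_distrib]
  · congr 1 <;> refine Finset.sum_congr rfl fun x _ => Finset.sum_congr rfl fun y _ => ?_
    · rw [hM (x, y), mul_comm]
    · rw [hM (a, p), mul_comm]
  · exact add_comm _ _

/-- From a symmetric divisible design with parameters `(v, k, λ₁, λ₂, m, n)` in which every
block contains exactly `c = k/m` points of each class (and dually), provided
`2(m−1)·k/m = λ₂ + (m−2)n`, the graph `A* = [[J − K, N], [Nᵀ, J − K]]` is a divisible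
design graph with parameters `(2v, k + (m−1)n, λ₁ + (m−1)n, λ₂ + (m−2)n, 2m, n)`. -/
theorem ddg_construction_sdd_join_classes (m n : ℕ) (hm : 0 < m) (hn : 0 < n)
    (k l1 l2 c : ℕ) (hk : k = c * m)
    (N : Matrix (Fin m × Fin n) (Fin m × Fin n) ℝ)
    (h01 : ∀ x y, N x y = 0 ∨ N x y = 1)
    (hNNt : N * Nᵀ = (k : ℝ) • (1 : Matrix (Fin m × Fin n) (Fin m × Fin n) ℝ)
        + (l1 : ℝ) • (Kmat m n - 1)
        + (l2 : ℝ) • (allOnes (Fin m × Fin n) - Kmat m n))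
    (hNtN : Nᵀ * N = (k : ℝ) • (1 : Matrix (Fin m × Fin n) (Fin m × Fin n) ℝ)
        + (l1 : ℝ) • (Kmat m n - 1)
        + (l2 : ℝ) • (allOnes (Fin m × Fin n) - Kmat m n))
    (hKN : Kmat m n * N = (c : ℝ) • allOnes (Fin m × Fin n))
    (hNK : N * Kmat m n = (c : ℝ) • allOnes (Fin m × Fin n))
    (hcond : 2 * ((m : ℝ) - 1) * (c : ℝ) = (l2 : ℝ) + ((m : ℝ) - 2) * (n : ℝ)) :
    IsDDGAdj ((k : ℝ) + ((m : ℝ) - 1) * (n : ℝ)) ((l1 : ℝ) + ((m : ℝ) - 1) * (n : ℝ))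
      ((l2 : ℝ) + ((m : ℝ) - 2) * (n : ℝ)) (sddGraph m n N) := by
  have hn' : n ≠ 0 := hn.ne'
  have hoff := allOnes_sub_Kmat_mul_add_mul hn' hKN hNK
  refine ⟨?_, ?_, ?_, ?_⟩
  · ext ⟨⟨i, a⟩, p⟩ ⟨⟨j, b⟩, q⟩
    fin_cases i <;> fin_cases j <;> simp [sddGraph, allOnes, Kmat_apply, eq_comm]
  · rintro ⟨⟨i, a⟩, p⟩ ⟨⟨j, b⟩, q⟩
    by_cases hij : i = j
    · by_cases hab : a = b <;> simp [sddGraph, allOnes, Kmat_apply, hij, hab]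
    · simp only [sddGraph, Matrix.of_apply, if_neg hij]
      split_ifs <;> exact h01 _ _
  · rintro ⟨⟨i, a⟩, p⟩
    simp [sddGraph, allOnes, Kmat_apply]
  · ext ⟨⟨i, a⟩, p⟩ ⟨⟨j, b⟩, q⟩
    rw [sddGraph_mul_self_apply]
    simp only [hNNt, hNtN, hoff, hcond, allOnes_sub_Kmat_mul_self, ite_self]
    by_cases hij : i = j
    · by_cases hab : a = b
      · by_cases hpq : p = q <;>
          simp [allOnes, Kmat_apply, hij, hab, hpq] <;> ring
      · simp [allOnes, Kmat_apply, hij, hab]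
        ring
    · simp [allOnes, hij]
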